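/- (Remark 3, axis identification) Let ABCD be a convex quadrilateral (no three vertices collinear) in the real affine plane with E = AB ∩ CD, F = BC ∩ AD, P = BD ∩ EF, R = AC ∩ EF, O = AC ∩ BD all existing, and let O₁, O₂, O₃ be the midpoints of the diagonals AC, BD, EF. Let J, K, L be the midpoints of AD, AE, DE (the medial triangle of triangle ADE). Then the corresponding sides of the triangles JKL and ORP meet on the Newton–Gauss line: O₁ lies on line JK and on line OR; O₂ lies on line JL and on line OP; O₃ lies on line KL and on line PR. -/

import Mathlib

/-- The real affine plane. -/
noncomputable abbrev Pt : Type := EuclideanSpace ℝ (Fin 2)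

/-- The line through two points `X`, `Y`: the affine span of `{X, Y}`. -/
noncomputable def line (X Y : Pt) : AffineSubspace ℝ Pt := affineSpan ℝ {X, Y}

theorem left_mem_line (X Y : Pt) : X ∈ line X Y := left_mem_affineSpan_pair ℝ X Y

theorem right_mem_line (X Y : Pt) : Y ∈ line X Y := right_mem_affineSpan_pair ℝ X Y

theorem midpoint_mem_line (X Y : Pt) : midpoint ℝ X Y ∈ line X Y :=
  AffineMap.lineMap_mem_affineSpan_pair _ X Y

/-- Two distinct points of a line determine it. -/
theorem mem_line_of_mem_of_ne {A B X Y Z : Pt} (hX : X ∈ line A B) (hY : Y ∈ line A B)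
    (hXY : X ≠ Y) (hZ : Z ∈ line A B) : Z ∈ line X Y := by
  have hcol : Collinear ℝ ({X, Y, Z} : Set Pt) :=
    collinear_triple_of_mem_affineSpan_pair hX hY hZ
  exact hcol.mem_affineSpan_of_mem_of_ne (by simp) (by simp) (by simp) hXY

/-- The homothety of ratio `1 / 2` centred at `A` maps lines to lines. -/
theorem midpoint_mem_line_midpoint (A : Pt) {X Y Z : Pt} (hZ : Z ∈ line X Y) :
    midpoint ℝ A Z ∈ line (midpoint ℝ A X) (midpoint ℝ A Y) := by
  obtain ⟨t, rfl⟩ := mem_affineSpan_pair_iff_exists_lineMap_eq.1 hZ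
  refine mem_affineSpan_pair_iff_exists_lineMap_eq.2 ⟨t, ?_⟩
  simp only [AffineMap.lineMap_apply_module, midpoint_eq_smul_add]
  module

/-- **Remark 3, axis identification.** In the complete quadrilateral `ABCDEF` with
diagonal triangle `POR`, let `J`, `K`, `L` be the midpoints of `AD`, `AE`, `DE`
(the medial triangle of triangle `ADE`), and let `O₁`, `O₂`, `O₃` be the midpoints of
the diagonals `AC`, `BD`, `EF` (all named points being pairwise distinct). Then the
corresponding sides of the triangles `JKL` and `ORP` meet on the Newton–Gauss line:
`O₁ ∈ JK ∩ OR`, `O₂ ∈ JL ∩ OP`, `O₃ ∈ KL ∩ PR`. -/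
theorem remark3_axis (A B C D E F P R O J K L O₁ O₂ O₃ : Pt)
    (h₁ : ¬ Collinear ℝ ({A, B, C} : Set Pt))
    (h₂ : ¬ Collinear ℝ ({A, B, D} : Set Pt))
    (h₃ : ¬ Collinear ℝ ({A, C, D} : Set Pt))
    (h₄ : ¬ Collinear ℝ ({B, C, D} : Set Pt))
    (hE₁ : E ∈ line A B) (hE₂ : E ∈ line C D)
    (hF₁ : F ∈ line B C) (hF₂ : F ∈ line A D)
    (hP₁ : P ∈ line B D) (hP₂ : P ∈ line E F)
    (hR₁ : R ∈ line A C) (hR₂ : R ∈ line E F)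
    (hO₁ : O ∈ line A C) (hO₂ : O ∈ line B D)
    (hJ : J = midpoint ℝ A D) (hK : K = midpoint ℝ A E) (hL : L = midpoint ℝ D E)
    (hO₁ : O₁ = midpoint ℝ A C) (hO₂ : O₂ = midpoint ℝ B D) (hO₃ : O₃ = midpoint ℝ E F)
    (hdist : List.Pairwise (· ≠ ·) [A, B, C, D, E, F, P, R, O, J, K, L, O₁, O₂, O₃]) :
    (O₁ ∈ line J K ∧ O₁ ∈ line O R) ∧
    (O₂ ∈ line J L ∧ O₂ ∈ line O P) ∧
    (O₃ ∈ line K L ∧ O₃ ∈ line P R) := by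
  have hOAC : O ∈ line A C := ‹_›
  have hOBD : O ∈ line B D := ‹_›
  simp only [List.pairwise_cons, List.mem_cons, forall_eq_or_imp] at hdist
  have hAE : A ≠ E := by tauto
  have hDE : D ≠ E := by tauto
  have hPR : P ≠ R := by tauto
  have hPO : P ≠ O := by tauto
  have hRO : R ≠ O := by tauto
  have hC : C ∈ line D E :=
    mem_line_of_mem_of_ne (right_mem_line C D) hE₂ hDE (left_mem_line C D)
  have hB : B ∈ line A E :=
    mem_line_of_mem_of_ne (left_mem_line A B) hE₁ hAE (right_mem_line A B)
  subst hJ hK hL hO₁ hO₂ hO₃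
  refine ⟨⟨midpoint_mem_line_midpoint A hC, ?_⟩, ⟨?_, ?_⟩, ?_, ?_⟩
  · exact mem_line_of_mem_of_ne hOAC hR₁ hRO.symm (midpoint_mem_line A C)
  · rw [midpoint_comm B D, midpoint_comm A D]
    exact midpoint_mem_line_midpoint D hB
  · exact mem_line_of_mem_of_ne hOBD hP₁ hPO.symm (midpoint_mem_line B D)
  · rw [midpoint_comm A E, midpoint_comm D E]
    exact midpoint_mem_line_midpoint E hF₂
  · exact mem_line_of_mem_of_ne hP₂ hR₂ hPR (midpoint_mem_line E F)
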